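/- Let μ be a probability measure on ℝ^d, F ⊂ ℝ^d a closed nonempty set, x, y ∈ ℝ^d, and let γ ∈ Γ_F(x,y) be a geodesic, i.e. D_μ(γ) = D_{μ,F}(x,y). Then |γ| ≤ (2^{β+2} + 1)·λ·‖x − y‖, where λ = 2c·ρ^{β+1}/(ρ − 1) with c = (16·5^β + 1152·165^β)/m^{2+β} and ρ = 1 + 32/m. -/

import Mathlib

open MeasureTheory Metric Set ProbabilityTheory
open scoped ENNReal NNReal

noncomputable section

/-- Euclidean space `ℝ^d`. -/
abbrev Euc (d : ℕ) := EuclideanSpace ℝ (Fin d)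

/-- The pseudo-distance-to-measure `δ_{μ,u}(x) = inf {r > 0 : μ(B(x,r)) > u}`. -/
def pseudoDTM {d : ℕ} (μ : Measure (Euc d)) (u : ℝ) (x : Euc d) : ℝ :=
  sInf {r : ℝ | 0 < r ∧ u < (μ (ball x r)).toReal}

/-- The distance-to-measure `d_μ(x) = ((1/m) ∫₀^m δ_{μ,u}(x)^p du)^{1/p}`. -/
def dtm {d : ℕ} (m p : ℝ) (μ : Measure (Euc d)) (x : Euc d) : ℝ :=
  ((1 / m) * ∫ u in Ioc (0 : ℝ) m, pseudoDTM μ u x ^ p) ^ (1 / p)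

/-- A Lipschitz path. -/
def IsLipschitzPath {d : ℕ} (γ : ℝ → Euc d) : Prop := ∃ K, LipschitzWith K γ

/-- Euclidean length `|γ| = ∫₀¹ ‖γ'(t)‖ dt`. -/
def eucLength {d : ℕ} (γ : ℝ → Euc d) : ℝ := ∫ t in Icc (0 : ℝ) 1, ‖deriv γ t‖

/-- FDTM length `D_μ(γ) = ∫₀¹ d_μ(γ(t))^β ‖γ'(t)‖ dt`. -/
def fdtmLength {d : ℕ} (m p β : ℝ) (μ : Measure (Euc d)) (γ : ℝ → Euc d) : ℝ :=
  ∫ t in Icc (0 : ℝ) 1, dtm m p μ (γ t) ^ β * ‖deriv γ t‖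

/-- Admissible paths `Γ_F(x,y)`: Lipschitz paths from `x` to `y` which may leave the domain `F`
only along straight lines. -/
def AdmissiblePath {d : ℕ} (F : Set (Euc d)) (x y : Euc d) (γ : ℝ → Euc d) : Prop :=
  IsLipschitzPath γ ∧ γ 0 = x ∧ γ 1 = y ∧
    ∀ a b : ℝ, 0 ≤ a → b ≤ 1 →
      (∀ t ∈ Ioo a b, γ t ∉ F) →
      ∃ u : Euc d, ‖u‖ = 1 ∧
        ∀ᵐ t ∂(volume.restrict (Ioo a b)), deriv γ t = ‖deriv γ t‖ • u

/-- The Fermat distance-to-measure `D_{μ,F}(x,y) = inf_{γ ∈ Γ_F(x,y)} D_μ(γ)`. -/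
def fdtm {d : ℕ} (m p β : ℝ) (μ : Measure (Euc d)) (F : Set (Euc d)) (x y : Euc d) : ℝ :=
  sInf {L : ℝ | ∃ γ : ℝ → Euc d, AdmissiblePath F x y γ ∧ L = fdtmLength m p β μ γ}

/-- A geodesic: an admissible path realizing the FDTM. -/
def IsGeodesic {d : ℕ} (m p β : ℝ) (μ : Measure (Euc d)) (F : Set (Euc d)) (x y : Euc d)
    (γ : ℝ → Euc d) : Prop :=
  AdmissiblePath F x y γ ∧ fdtmLength m p β μ γ = fdtm m p β μ F x y

/-- FDTM length of the straight segment `[x,y]`. -/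
def segFDTM {d : ℕ} (m p β : ℝ) (μ : Measure (Euc d)) (x y : Euc d) : ℝ :=
  ‖x - y‖ * ∫ t in Icc (0 : ℝ) 1, dtm m p μ ((1 - t) • x + t • y) ^ β

/-- The explicit constant `λ = 2·c·ρ^{β+1}/(ρ−1)` with `c = (16·5^β + 1152·165^β)/m^{2+β}`
and `ρ = 1 + 32/m`. -/
def fdtmConst (m β : ℝ) : ℝ :=
  2 * ((16 * (5 : ℝ) ^ β + 1152 * (165 : ℝ) ^ β) / m ^ (2 + β)) * (1 + 32 / m) ^ (β + 1) /
    ((1 + 32 / m) - 1)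

/-- Support of a measure: points all of whose neighborhoods have positive mass. -/
def measSupport {d : ℕ} (μ : Measure (Euc d)) : Set (Euc d) :=
  {x | ∀ r : ℝ, 0 < r → 0 < μ (ball x r)}

/-- `(a,b)`-standard measure: `μ(B(x,r)) ≥ a·r^b` for `x ∈ supp(μ)` and `0 < r ≤ a^{-1/b}`. -/
def IsStandard {d : ℕ} (μ : Measure (Euc d)) (a b : ℝ) : Prop :=
  ∀ x ∈ measSupport μ, ∀ r : ℝ, 0 < r → r ≤ a ^ (-(1 / b)) → a * r ^ b ≤ (μ (ball x r)).toReal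

section DTM

variable {d : ℕ} {m p : ℝ} {μ : Measure (Euc d)}

lemma pseudoDTM_nonneg (u : ℝ) (x : Euc d) : 0 ≤ pseudoDTM μ u x :=
  Real.sInf_nonneg fun _ hr => hr.1.le

lemma bddBelow_pseudoDTM (u : ℝ) (x : Euc d) :
    BddBelow {r : ℝ | 0 < r ∧ u < (μ (ball x r)).toReal} :=
  ⟨0, fun _ hr => hr.1.le⟩

lemma exists_lt_measure_ball [IsProbabilityMeasure μ] {u : ℝ} (hu : u < 1) (x : Euc d) :
    {r : ℝ | 0 < r ∧ u < (μ (ball x r)).toReal}.Nonempty := by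
  have hmono : Monotone fun n : ℕ => ball x (n : ℝ) :=
    fun a b hab => ball_subset_ball (by exact_mod_cast hab)
  have h1 := tendsto_measure_iUnion_atTop (μ := μ) hmono
  rw [iUnion_ball_nat, measure_univ] at h1
  have h2 := (ENNReal.tendsto_toReal ENNReal.one_ne_top).comp h1
  have h3 := h2.eventually (lt_mem_nhds (a := u) (by simpa using hu))
  obtain ⟨n, hn, hn0⟩ := (h3.and (Filter.eventually_gt_atTop 0)).exists
  exact ⟨n, by exact_mod_cast hn0, hn⟩

lemma monotoneOn_pseudoDTM [IsProbabilityMeasure μ] (x : Euc d) :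
    MonotoneOn (fun u => pseudoDTM μ u x) (Iio 1) := fun _ _ _ hv huv =>
  csInf_le_csInf (bddBelow_pseudoDTM _ x) (exists_lt_measure_ball hv x)
    fun _ hr => ⟨hr.1, huv.trans_lt hr.2⟩

lemma pseudoDTM_le_add_dist [IsProbabilityMeasure μ] {u : ℝ} (hu : u < 1) (x y : Euc d) :
    pseudoDTM μ u x ≤ pseudoDTM μ u y + dist x y := by
  rw [← sub_le_iff_le_add]
  refine le_csInf (exists_lt_measure_ball hu y) fun r hr => ?_
  rw [sub_le_iff_le_add]
  refine csInf_le (bddBelow_pseudoDTM _ x) ⟨by linarith [hr.1, dist_nonneg (x := x) (y := y)], ?_⟩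
  refine hr.2.trans_le (ENNReal.toReal_mono (measure_ne_top _ _) (measure_mono ?_))
  exact ball_subset_ball' (by rw [dist_comm])

lemma dtm_nonneg (x : Euc d) (hm : 0 < m) : 0 ≤ dtm m p μ x :=
  Real.rpow_nonneg (mul_nonneg (by positivity) (integral_nonneg fun u =>
    Real.rpow_nonneg (pseudoDTM_nonneg u x) _)) _

/-- The uniform probability measure on `(0, m]`. -/
def unifIoc (m : ℝ) : Measure ℝ := ENNReal.ofReal (1 / m) • volume.restrict (Ioc 0 m)

lemma isProbabilityMeasure_unifIoc (hm : 0 < m) : IsProbabilityMeasure (unifIoc m) := by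
  refine ⟨?_⟩
  simp only [unifIoc, Measure.smul_apply, Measure.restrict_apply_univ, Real.volume_Ioc, sub_zero,
    smul_eq_mul]
  rw [← ENNReal.ofReal_mul (by positivity), one_div_mul_cancel hm.ne', ENNReal.ofReal_one]

lemma ae_unifIoc : ∀ᵐ u ∂unifIoc m, u ∈ Ioc 0 m :=
  Measure.ae_smul_measure (ae_restrict_mem measurableSet_Ioc) _

lemma memLp_pseudoDTM [IsProbabilityMeasure μ] (hm : m ∈ Ioo (0 : ℝ) 1) (q : ℝ≥0∞) (x : Euc d) :
    MemLp (fun u => pseudoDTM μ u x) q (unifIoc m) := by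
  have := isProbabilityMeasure_unifIoc hm.1
  have hsub : Ioc 0 m ⊆ Iio (1 : ℝ) := fun u hu => hu.2.trans_lt hm.2
  have h1 : AEMeasurable (fun u => pseudoDTM μ u x) (unifIoc m) :=
    (aemeasurable_restrict_of_monotoneOn measurableSet_Ioc
      ((monotoneOn_pseudoDTM x).mono hsub)).smul_measure _
  refine MemLp.of_bound h1.aestronglyMeasurable (pseudoDTM μ m x) ?_
  filter_upwards [ae_unifIoc] with u hu
  rw [Real.norm_of_nonneg (pseudoDTM_nonneg u x)]
  exact monotoneOn_pseudoDTM x (hsub hu) hm.2 hu.2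

lemma dtm_eq_integral_unifIoc (hm : 0 < m) (x : Euc d) :
    dtm m p μ x = (∫ u, pseudoDTM μ u x ^ p ∂unifIoc m) ^ (1 / p) := by
  rw [dtm, unifIoc, integral_smul_measure, ENNReal.toReal_ofReal (by positivity), smul_eq_mul]

lemma ofReal_dtm [IsProbabilityMeasure μ] (hm : m ∈ Ioo (0 : ℝ) 1) (hp : 1 ≤ p) (x : Euc d) :
    ENNReal.ofReal (dtm m p μ x) =
      eLpNorm (fun u => pseudoDTM μ u x) (ENNReal.ofReal p) (unifIoc m) := by
  rw [(memLp_pseudoDTM hm _ x).eLpNorm_eq_integral_rpow_norm (by simp; linarith) (by simp),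
    dtm_eq_integral_unifIoc hm.1, ENNReal.toReal_ofReal (by linarith), one_div]
  simp_rw [Real.norm_of_nonneg (pseudoDTM_nonneg _ _)]

lemma dtm_le_add_dist [IsProbabilityMeasure μ] (hm : m ∈ Ioo (0 : ℝ) 1) (hp : 1 ≤ p)
    (x y : Euc d) : dtm m p μ x ≤ dtm m p μ y + dist x y := by
  have := isProbabilityMeasure_unifIoc hm.1
  have hp0 : ENNReal.ofReal p ≠ 0 := by simp; linarith
  rw [← ENNReal.ofReal_le_ofReal_iff (add_nonneg (dtm_nonneg y hm.1) dist_nonneg),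
    ENNReal.ofReal_add (dtm_nonneg y hm.1) dist_nonneg, ofReal_dtm hm hp, ofReal_dtm hm hp]
  calc eLpNorm (fun u => pseudoDTM μ u x) (ENNReal.ofReal p) (unifIoc m)
      ≤ eLpNorm ((fun u => pseudoDTM μ u y) + fun _ => dist x y) (ENNReal.ofReal p)
          (unifIoc m) := by
        refine eLpNorm_mono_ae ?_
        filter_upwards [ae_unifIoc] with u hu
        have h0 := pseudoDTM_nonneg (μ := μ) u y
        rw [Pi.add_apply, Real.norm_of_nonneg (pseudoDTM_nonneg u x),
          Real.norm_of_nonneg (add_nonneg h0 dist_nonneg)]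
        exact pseudoDTM_le_add_dist (hu.2.trans_lt hm.2) x y
    _ ≤ _ + eLpNorm (fun _ => dist x y) (ENNReal.ofReal p) (unifIoc m) :=
        eLpNorm_add_le (memLp_pseudoDTM hm 1 y).1 aestronglyMeasurable_const (by simpa using hp)
    _ = _ := by
        rw [eLpNorm_const _ hp0 (IsProbabilityMeasure.ne_zero _), measure_univ, ENNReal.one_rpow, mul_one,
          Real.enorm_of_nonneg dist_nonneg]

lemma lipschitzWith_dtm [IsProbabilityMeasure μ] (hm : m ∈ Ioo (0 : ℝ) 1) (hp : 1 ≤ p) :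
    LipschitzWith 1 (dtm m p μ) :=
  LipschitzWith.of_le_add fun x y => dtm_le_add_dist hm hp x y

lemma half_lt_measure_ball_of_dtm_le [IsProbabilityMeasure μ] (hm : m ∈ Ioo (0 : ℝ) 1)
    (hp : 1 ≤ p) {r : ℝ} (hr : 0 < r) {z : Euc d} (hz : dtm m p μ z ≤ r) :
    m / 2 < (μ (ball z (3 * r))).toReal := by
  by_contra! hle
  have hint : IntegrableOn (fun u => pseudoDTM μ u z ^ p) (Ioc 0 m) := by
    have h := (memLp_pseudoDTM (μ := μ) hm (ENNReal.ofReal p) z).integrable_norm_rpow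
      (by simp; linarith) (by simp)
    simp_rw [Real.norm_of_nonneg (pseudoDTM_nonneg _ _)] at h
    rw [ENNReal.toReal_ofReal (by linarith), unifIoc, integrable_smul_measure
      (by simpa using hm.1) (by simp)] at h
    exact h
  have hlow : ∀ u ∈ Ioc (m / 2) m, (3 * r) ^ p ≤ pseudoDTM μ u z ^ p := by
    intro u hu
    refine Real.rpow_le_rpow (by positivity) ?_ (by linarith)
    refine le_csInf (exists_lt_measure_ball (hu.2.trans_lt hm.2) z) fun s hs => ?_
    by_contra! hlt
    have := ENNReal.toReal_mono (measure_ne_top μ _) (measure_mono (ball_subset_ball hlt.le) :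
      μ (ball z s) ≤ μ (ball z (3 * r)))
    linarith [hs.2, hu.1]
  have hsub : Ioc (m / 2) m ⊆ Ioc 0 m := Ioc_subset_Ioc_left (by linarith [hm.1])
  have h1 : m / 2 * (3 * r) ^ p ≤ ∫ u in Ioc (0 : ℝ) m, pseudoDTM μ u z ^ p := by
    calc m / 2 * (3 * r) ^ p = ∫ _ in Ioc (m / 2) m, (3 * r) ^ p := by
          rw [setIntegral_const, Real.volume_real_Ioc_of_le (by linarith [hm.1]), smul_eq_mul]
          ring
      _ ≤ ∫ u in Ioc (m / 2) m, pseudoDTM μ u z ^ p :=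
          setIntegral_mono_on (by simp) (hint.mono_set hsub) measurableSet_Ioc hlow
      _ ≤ _ := setIntegral_mono_set hint
          (ae_of_all _ fun u => Real.rpow_nonneg (pseudoDTM_nonneg u z) p) hsub.eventuallyLE
  have h2 : (1 / m) * ∫ u in Ioc (0 : ℝ) m, pseudoDTM μ u z ^ p ≤ r ^ p := by
    rw [dtm] at hz
    have hn : 0 ≤ (1 / m) * ∫ u in Ioc (0 : ℝ) m, pseudoDTM μ u z ^ p :=
      mul_nonneg (by have := hm.1; positivity)
        (integral_nonneg fun u => Real.rpow_nonneg (pseudoDTM_nonneg u z) _)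
    rwa [one_div p, Real.rpow_inv_le_iff_of_pos hn hr.le (by linarith)] at hz
  rw [Real.mul_rpow (by norm_num) hr.le] at h1
  have h3 : (3 : ℝ) ≤ 3 ^ p := Real.self_le_rpow_of_one_le (by norm_num) hp
  have hrp : 0 < r ^ p := Real.rpow_pos_of_pos hr p
  have h4 : ∫ u in Ioc (0 : ℝ) m, pseudoDTM μ u z ^ p ≤ m * r ^ p := by
    rw [one_div, inv_mul_le_iff₀ hm.1] at h2
    exact h2
  have h5 : m * (3 * r ^ p) ≤ m * (3 ^ p * r ^ p) := by
    have := hm.1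
    gcongr
  have h6 : 0 < m * r ^ p := mul_pos hm.1 hrp
  linarith

lemma card_le_of_separated [IsProbabilityMeasure μ] (hm : m ∈ Ioo (0 : ℝ) 1)
    (hp : 1 ≤ p) {r : ℝ} (hr : 0 < r) (T : Finset (Euc d)) (hT : ∀ z ∈ T, dtm m p μ z ≤ r)
    (hsep : ∀ z ∈ T, ∀ w ∈ T, z ≠ w → 6 * r ≤ dist z w) : (T.card : ℝ) ≤ 2 / m := by
  have hdisj : (T : Set (Euc d)).PairwiseDisjoint fun z => ball z (3 * r) :=
    fun z hz w hw hzw => ball_disjoint_ball (by linarith [hsep z hz w hw hzw])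
  have h1 : ∑ z ∈ T, μ.real (ball z (3 * r)) ≤ 1 := by
    rw [← measureReal_biUnion_finset hdisj fun _ _ => measurableSet_ball]
    exact measureReal_le_one
  have h2 : (T.card : ℝ) * (m / 2) ≤ ∑ z ∈ T, μ.real (ball z (3 * r)) := by
    rw [← nsmul_eq_mul]
    exact Finset.card_nsmul_le_sum _ _ _ fun z hz =>
      (half_lt_measure_ball_of_dtm_le hm hp hr (hT z hz)).le
  rw [le_div_iff₀ hm.1]
  linarith

lemma exists_finset_cover_dtm_le [IsProbabilityMeasure μ] (hm : m ∈ Ioo (0 : ℝ) 1)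
    (hp : 1 ≤ p) {r : ℝ} (hr : 0 < r) :
    ∃ T : Finset (Euc d), (T.card : ℝ) ≤ 2 / m ∧ (∀ z ∈ T, dtm m p μ z ≤ r) ∧
      ∀ w, dtm m p μ w ≤ r → ∃ z ∈ T, w ∈ closedBall z (6 * r) := by
  classical
  let P : Finset (Euc d) → Prop := fun T => (∀ z ∈ T, dtm m p μ z ≤ r) ∧
    ∀ z ∈ T, ∀ w ∈ T, z ≠ w → 6 * r ≤ dist z w
  let S : Set ℕ := {n | ∃ T, P T ∧ T.card = n}
  have hne : S.Nonempty := ⟨0, ∅, ⟨by simp, by simp⟩, by simp⟩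
  have hbdd : BddAbove S := by
    refine ⟨⌊2 / m⌋₊, ?_⟩
    rintro _ ⟨T, hT, rfl⟩
    exact Nat.le_floor (card_le_of_separated hm hp hr T hT.1 hT.2)
  obtain ⟨T, hT, hcard⟩ := Nat.sSup_mem hne hbdd
  refine ⟨T, card_le_of_separated hm hp hr T hT.1 hT.2, hT.1, fun w hw => ?_⟩
  by_contra! hfar
  have hfar' : ∀ z ∈ T, 6 * r < dist w z := fun z hz => by simpa using hfar z hz
  have hwT : w ∉ T := fun h => by
    have := hfar' w h
    rw [dist_self] at this
    linarith
  have hP : P (insert w T) := by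
    refine ⟨fun z hz => ?_, fun z hz v hv hzv => ?_⟩
    · rcases Finset.mem_insert.1 hz with rfl | hz
      exacts [hw, hT.1 z hz]
    · rcases Finset.mem_insert.1 hz with hz | hz <;> rcases Finset.mem_insert.1 hv with hv | hv
      · exact absurd (hz.trans hv.symm) hzv
      · rw [hz]; exact (hfar' v hv).le
      · rw [hv, dist_comm]; exact (hfar' z hz).le
      · exact hT.2 z hz v hv hzv
  have := le_csSup hbdd (⟨_, hP, rfl⟩ : (insert w T).card ∈ S)
  rw [Finset.card_insert_of_notMem hwT] at this
  omega

lemma finite_dtm_eq_zero [IsProbabilityMeasure μ] (hm : m ∈ Ioo (0 : ℝ) 1) (hp : 1 ≤ p) :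
    {z : Euc d | dtm m p μ z = 0}.Finite := by
  by_contra hinf
  obtain ⟨T, hT, hcard⟩ := Set.Infinite.exists_subset_card_eq hinf (⌊2 / m⌋₊ + 2)
  have hnt : (T : Set (Euc d)).Nontrivial :=
    Finset.one_lt_card_iff_nontrivial.1 (by omega)
  have hpos := (T.infsep_pos_iff_nontrivial).2 hnt
  have := card_le_of_separated (r := (T : Set (Euc d)).infsep / 6) hm hp (by positivity) T
    (fun z hz => by rw [show dtm m p μ z = 0 from hT hz]; positivity)
    (fun z hz w hw hzw => by
      rw [mul_div_cancel₀ _ (by norm_num)]; exact Set.infsep_le_dist_of_mem hz hw hzw)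
  have := Nat.le_floor this
  omega

end DTM

section Speed

variable {d : ℕ} {γ : ℝ → Euc d} {K : ℝ≥0}

/-- The length measure of a path: the measure on `[0, 1]` with density `‖γ'‖`. -/
def speedMeasure (γ : ℝ → Euc d) : Measure ℝ :=
  (volume.restrict (Icc 0 1)).withDensity fun t => ‖deriv γ t‖ₑ

lemma isFiniteMeasure_speedMeasure (hγ : LipschitzWith K γ) :
    IsFiniteMeasure (speedMeasure γ) := by
  refine isFiniteMeasure_withDensity ((lintegral_mono (g := fun _ => (K : ℝ≥0∞)) fun _ => ?_).trans_lt
    (by simp)).ne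
  rw [enorm_le_coe]
  exact norm_deriv_le_of_lipschitz hγ

lemma integrable_deriv_lipschitz (hγ : LipschitzWith K γ) (S : Set ℝ) (hS : volume S ≠ ∞) :
    IntegrableOn (deriv γ) S :=
  Measure.integrableOn_of_bounded hS (measurable_deriv γ).aestronglyMeasurable (M := K)
    (ae_of_all _ fun _ => norm_deriv_le_of_lipschitz hγ)

lemma speedMeasure_apply (S : Set ℝ) (hS : MeasurableSet S) :
    speedMeasure γ S = ∫⁻ t in S ∩ Icc 0 1, ‖deriv γ t‖ₑ := by
  rw [speedMeasure, withDensity_apply _ hS, Measure.restrict_restrict hS]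

lemma speedMeasure_real (S : Set ℝ) (hS : MeasurableSet S) :
    (speedMeasure γ).real S = ∫ t in S ∩ Icc 0 1, ‖deriv γ t‖ := by
  rw [integral_norm_eq_lintegral_enorm (measurable_deriv γ).aestronglyMeasurable,
    ← speedMeasure_apply S hS, measureReal_def]

lemma eucLength_eq_speedMeasure : eucLength γ = (speedMeasure γ).real univ := by
  rw [speedMeasure_real _ MeasurableSet.univ, univ_inter, eucLength]

lemma speedMeasure_absolutelyContinuous : speedMeasure γ ≪ volume :=
  (withDensity_absolutelyContinuous _ _).trans Measure.absolutelyContinuous_restrict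

instance : NullSingletonClass (speedMeasure γ) :=
  ⟨fun t => speedMeasure_absolutelyContinuous (measure_singleton t)⟩

lemma integral_inner_deriv (hγ : LipschitzWith K γ) (w : Euc d) (s t : ℝ) :
    ∫ τ in s..t, inner ℝ w (deriv γ τ) = inner ℝ w (γ t - γ s) := by
  obtain ⟨C, hC⟩ : ∃ C, LipschitzWith C fun τ => inner ℝ w (γ τ) :=
    ⟨_, (innerSL ℝ w).lipschitz.comp hγ⟩
  rw [inner_sub_right, ← (hC.lipschitzOnWith.absolutelyContinuousOnInterval).integral_deriv_eq_sub]
  refine intervalIntegral.integral_congr_ae ?_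
  filter_upwards [hγ.ae_differentiableAt_real] with τ hτ _
  exact (((innerSL ℝ w).hasFDerivAt.comp_hasDerivAt τ hτ.hasDerivAt).deriv).symm

lemma norm_sub_le_speedMeasure (hγ : LipschitzWith K γ) {s t : ℝ} (hs : 0 ≤ s) (hst : s ≤ t)
    (ht : t ≤ 1) : ‖γ t - γ s‖ ≤ (speedMeasure γ).real (Icc s t) := by
  rcases eq_or_ne (γ t - γ s) 0 with h0 | h0
  · rw [h0, norm_zero]; positivity
  set v := γ t - γ s with hv
  have h1 := integral_inner_deriv hγ v s t
  rw [← hv, real_inner_self_eq_norm_sq, intervalIntegral.integral_of_le hst,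
    ← integral_Icc_eq_integral_Ioc] at h1
  have hint := integrable_deriv_lipschitz hγ (Icc s t) (by simp)
  have h2 : ‖v‖ ^ 2 ≤ ‖v‖ * (speedMeasure γ).real (Icc s t) := by
    rw [speedMeasure_real _ measurableSet_Icc,
      inter_eq_left.2 (Icc_subset_Icc hs ht), ← integral_const_mul, ← h1]
    refine integral_mono (hint.const_inner v) (hint.norm.const_mul _) fun τ => ?_
    exact real_inner_le_norm _ _
  have h3 : 0 < ‖v‖ := norm_pos_iff.2 h0
  nlinarith

lemma speedMeasure_le_norm_sub (hγ : LipschitzWith K γ) {a b s t : ℝ} {u : Euc d} (hu : ‖u‖ = 1)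
    (ha : 0 ≤ a) (hb : b ≤ 1) (has : a ≤ s) (hst : s ≤ t) (htb : t ≤ b)
    (h : ∀ᵐ τ ∂(volume.restrict (Ioo a b)), deriv γ τ = ‖deriv γ τ‖ • u) :
    (speedMeasure γ).real (Icc s t) ≤ ‖γ t - γ s‖ := by
  have h1 := integral_inner_deriv hγ u s t
  rw [intervalIntegral.integral_of_le hst, integral_Ioc_eq_integral_Ioo] at h1
  have h2 : (speedMeasure γ).real (Icc s t) = inner ℝ u (γ t - γ s) := by
    rw [speedMeasure_real _ measurableSet_Icc,
      inter_eq_left.2 (Icc_subset_Icc (ha.trans has) (htb.trans hb)), ← h1,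
      integral_Icc_eq_integral_Ioc, integral_Ioc_eq_integral_Ioo]
    refine integral_congr_ae ?_
    filter_upwards [ae_restrict_of_ae_restrict_of_subset (Ioo_subset_Ioo has htb) h] with τ hτ
    rw [hτ, inner_smul_right, real_inner_self_eq_norm_sq, hu, norm_smul, hu]
    simp
  rw [h2]
  simpa [hu] using real_inner_le_norm u (γ t - γ s)

lemma speedMeasure_preimage_singleton (hγ : Continuous γ) (z : Euc d) :
    speedMeasure γ (γ ⁻¹' {z}) = 0 := by
  obtain ⟨V, D, hV, hD, h⟩ :=
    exists_countable_union_perfect_of_isClosed ((isClosed_singleton (x := z)).preimage hγ)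
  rw [h]
  refine measure_union_null (hV.measure_zero _) ?_
  rw [speedMeasure_apply _ hD.closed.measurableSet]
  refine (setLIntegral_congr_fun (hD.closed.measurableSet.inter measurableSet_Icc)
    fun t ht => ?_).trans lintegral_zero
  rw [enorm_eq_zero]
  refine deriv_zero_of_frequently_const (c := z) ?_
  have hacc := hD.acc t ht.1
  rw [accPt_iff_frequently] at hacc
  rw [frequently_nhdsWithin_iff]
  refine hacc.mono fun y hy => ⟨?_, hy.1⟩
  have : y ∈ γ ⁻¹' {z} := h ▸ Or.inr hy.2
  exact this

lemma speedMeasure_straight_ball (hγ : LipschitzWith K γ) {a b R : ℝ} {u z : Euc d} (hu : ‖u‖ = 1)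
    (ha : 0 ≤ a) (hb : b ≤ 1) (hR : 0 ≤ R)
    (h : ∀ᵐ τ ∂(volume.restrict (Ioo a b)), deriv γ τ = ‖deriv γ τ‖ • u) :
    (speedMeasure γ).real (Icc a b ∩ γ ⁻¹' closedBall z R) ≤ 2 * R := by
  have := isFiniteMeasure_speedMeasure hγ
  set A := Icc a b ∩ γ ⁻¹' closedBall z R with hA
  have hcpt : IsCompact A := isCompact_Icc.inter_right (isClosed_closedBall.preimage hγ.continuous)
  rcases A.eq_empty_or_nonempty with h0 | h0
  · rw [h0, measureReal_empty]; positivity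
  have hs := hcpt.sInf_mem h0
  have ht := hcpt.sSup_mem h0
  have hsub : A ⊆ Icc (sInf A) (sSup A) := subset_Icc_csInf_csSup hcpt.bddBelow hcpt.bddAbove
  calc (speedMeasure γ).real A ≤ (speedMeasure γ).real (Icc (sInf A) (sSup A)) :=
        measureReal_mono hsub
    _ ≤ ‖γ (sSup A) - γ (sInf A)‖ :=
        speedMeasure_le_norm_sub hγ hu ha hb hs.1.1 (hsub hs).2 ht.1.2 h
    _ ≤ 2 * R := by
        rw [← dist_eq_norm]
        linarith [dist_triangle_right (γ (sSup A)) (γ (sInf A)) z, mem_closedBall.1 hs.2,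
          mem_closedBall.1 ht.2]

end Speed

section Components

variable {d : ℕ} {γ : ℝ → Euc d} {K : ℝ≥0} {F : Set (Euc d)}

/-- The times in `[0, 1]` at which `γ` is in `F` or at one of its endpoints. -/
def nodes (F : Set (Euc d)) (γ : ℝ → Euc d) : Set ℝ := {t ∈ Icc 0 1 | γ t ∈ F ∨ t = 0 ∨ t = 1}

/-- The last node before `t`. -/
def prevNode (F : Set (Euc d)) (γ : ℝ → Euc d) (t : ℝ) : ℝ := sSup (nodes F γ ∩ Iic t)

/-- The first node after `t`. -/
def nextNode (F : Set (Euc d)) (γ : ℝ → Euc d) (t : ℝ) : ℝ := sInf (nodes F γ ∩ Ici t)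

lemma isCompact_nodes (hF : IsClosed F) (hγ : Continuous γ) : IsCompact (nodes F γ) := by
  have : nodes F γ = Icc 0 1 ∩ (γ ⁻¹' F ∪ ({0} ∪ {1})) := by
    ext t
    simp only [nodes, mem_ofPred_eq, mem_inter_iff, mem_union, mem_preimage, mem_singleton_iff]
  rw [this]
  exact isCompact_Icc.inter_right
    ((hF.preimage hγ).union (isClosed_singleton.union isClosed_singleton))

lemma prevNode_mem (hF : IsClosed F) (hγ : Continuous γ) {t : ℝ} (ht : t ∈ Icc (0 : ℝ) 1) :
    prevNode F γ t ∈ nodes F γ ∩ Iic t :=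
  ((isCompact_nodes hF hγ).inter_right isClosed_Iic).sSup_mem
    ⟨0, by simp [nodes], ht.1⟩

lemma nextNode_mem (hF : IsClosed F) (hγ : Continuous γ) {t : ℝ} (ht : t ∈ Icc (0 : ℝ) 1) :
    nextNode F γ t ∈ nodes F γ ∩ Ici t :=
  ((isCompact_nodes hF hγ).inter_right isClosed_Ici).sInf_mem
    ⟨1, by simp [nodes], ht.2⟩

lemma le_prevNode {s t : ℝ} (hs : s ∈ nodes F γ) (hst : s ≤ t) : s ≤ prevNode F γ t :=
  le_csSup ⟨t, fun _ h => h.2⟩ ⟨hs, hst⟩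

lemma nextNode_le {s t : ℝ} (hs : s ∈ nodes F γ) (hst : t ≤ s) : nextNode F γ t ≤ s :=
  csInf_le ⟨t, fun _ h => h.2⟩ ⟨hs, hst⟩

lemma notMem_nodes_of_mem_Ioo {s t : ℝ} (hs : s ∈ Ioo (prevNode F γ t) (nextNode F γ t)) :
    s ∉ nodes F γ := fun h => by
  rcases le_total s t with hst | hst
  · exact (le_prevNode h hst).not_gt hs.1
  · exact (nextNode_le h hst).not_gt hs.2

lemma prevNode_eq (hF : IsClosed F) (hγ : Continuous γ) {s t : ℝ} (ht : t ∈ Icc (0 : ℝ) 1)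
    (hs : s ∈ Ioo (prevNode F γ t) (nextNode F γ t)) : prevNode F γ s = prevNode F γ t := by
  have h1 := prevNode_mem hF hγ ht
  refine le_antisymm (csSup_le ⟨_, h1.1, hs.1.le⟩ fun r hr => ?_) (le_prevNode h1.1 hs.1.le)
  by_contra! hlt
  exact notMem_nodes_of_mem_Ioo ⟨hlt, lt_of_le_of_lt hr.2 hs.2⟩ hr.1

lemma nextNode_eq (hF : IsClosed F) (hγ : Continuous γ) {s t : ℝ} (ht : t ∈ Icc (0 : ℝ) 1)
    (hs : s ∈ Ioo (prevNode F γ t) (nextNode F γ t)) : nextNode F γ s = nextNode F γ t := by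
  have h1 := nextNode_mem hF hγ ht
  refine le_antisymm (nextNode_le h1.1 hs.2.le) (le_csInf ⟨_, h1.1, hs.2.le⟩ fun r hr => ?_)
  by_contra! hlt
  exact notMem_nodes_of_mem_Ioo ⟨lt_of_lt_of_le hs.1 hr.2, hlt⟩ hr.1

lemma mem_Ioo_nodes (hF : IsClosed F) (hγ : Continuous γ) {t : ℝ} (ht : t ∈ Icc (0 : ℝ) 1)
    (htn : t ∉ nodes F γ) : t ∈ Ioo (prevNode F γ t) (nextNode F γ t) := by
  have h1 := prevNode_mem hF hγ ht
  have h2 := nextNode_mem hF hγ ht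
  exact ⟨lt_of_le_of_ne h1.2 fun h => htn (h ▸ h1.1),
    lt_of_le_of_ne h2.2 fun h => htn (h.symm ▸ h2.1)⟩

lemma AdmissiblePath.straight {x y : Euc d} (h : AdmissiblePath F x y γ) (hF : IsClosed F)
    (hγ : Continuous γ) {t : ℝ} (ht : t ∈ Icc (0 : ℝ) 1) :
    ∃ u : Euc d, ‖u‖ = 1 ∧ ∀ᵐ s ∂(volume.restrict (Ioo (prevNode F γ t) (nextNode F γ t))),
      deriv γ s = ‖deriv γ s‖ • u := by
  have h1 := (prevNode_mem hF hγ ht).1.1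
  have h2 := (nextNode_mem hF hγ ht).1.1
  refine h.2.2.2 _ _ h1.1 h2.2 fun s hs hsF => notMem_nodes_of_mem_Ioo hs ?_
  exact ⟨⟨h1.1.trans hs.1.le, hs.2.le.trans h2.2⟩, Or.inl hsF⟩

variable {m p : ℝ} {μ : Measure (Euc d)}

lemma speedMeasure_straight_low_le [IsProbabilityMeasure μ] (hm : m ∈ Ioo (0 : ℝ) 1)
    (hp : 1 ≤ p) (hγ : LipschitzWith K γ) {a b : ℝ} {u : Euc d} (hu : ‖u‖ = 1)
    (ha : 0 ≤ a) (hb : b ≤ 1)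
    (h : ∀ᵐ τ ∂(volume.restrict (Ioo a b)), deriv γ τ = ‖deriv γ τ‖ • u) :
    (speedMeasure γ).real (Ioo a b ∩
        {t | dtm m p μ (γ t) < m / 48 * (speedMeasure γ).real (Icc a b)}) ≤
      (speedMeasure γ).real (Ioo a b ∩
        {t | m / 48 * (speedMeasure γ).real (Icc a b) ≤ dtm m p μ (γ t)}) := by
  have := isFiniteMeasure_speedMeasure hγ
  set ν := speedMeasure γ with hν
  set ℓ := ν.real (Icc a b) with hℓ
  have hm0 := hm.1
  have hIoo : ν.real (Ioo a b) = ℓ := by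
    rw [hℓ]; exact measureReal_congr Ioo_ae_eq_Icc
  rcases (measureReal_nonneg : 0 ≤ ν.real (Icc a b)).eq_or_lt with h0 | hpos
  · refine le_trans ?_ measureReal_nonneg
    exact (measureReal_mono inter_subset_left).trans (by rw [hIoo, hℓ, ← h0])
  have hr : 0 < m / 48 * ℓ := mul_pos (by positivity) hpos
  obtain ⟨T, hcard, -, hT⟩ := exists_finset_cover_dtm_le (μ := μ) hm hp hr
  have h1 : ν.real (Ioo a b ∩ {t | dtm m p μ (γ t) < m / 48 * ℓ}) ≤ ℓ / 2 := by
    calc ν.real (Ioo a b ∩ {t | dtm m p μ (γ t) < m / 48 * ℓ})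
        ≤ ν.real (⋃ z ∈ T, Icc a b ∩ γ ⁻¹' closedBall z (6 * (m / 48 * ℓ))) := by
          refine measureReal_mono (fun t ht => ?_) (measure_ne_top _ _)
          obtain ⟨z, hz, htz⟩ := hT (γ t) (le_of_lt ht.2)
          exact mem_biUnion hz ⟨Ioo_subset_Icc_self ht.1, htz⟩
      _ ≤ ∑ z ∈ T, ν.real (Icc a b ∩ γ ⁻¹' closedBall z (6 * (m / 48 * ℓ))) :=
          measureReal_biUnion_finset_le _ _
      _ ≤ T.card • (2 * (6 * (m / 48 * ℓ))) := Finset.sum_le_card_nsmul _ _ _ fun z _ =>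
          speedMeasure_straight_ball hγ hu ha hb (by positivity) h
      _ ≤ 2 / m * (2 * (6 * (m / 48 * ℓ))) := by
          rw [nsmul_eq_mul]; gcongr
      _ = ℓ / 2 := by field_simp; ring
  have h2 : ℓ ≤ ν.real (Ioo a b ∩ {t | dtm m p μ (γ t) < m / 48 * ℓ}) +
      ν.real (Ioo a b ∩ {t | m / 48 * ℓ ≤ dtm m p μ (γ t)}) := by
    refine hIoo.symm.le.trans ((measureReal_mono fun t ht => ?_).trans (measureReal_union_le _ _))
    rw [← inter_union_distrib_left]
    exact ⟨ht, lt_or_ge (dtm m p μ (γ t)) _⟩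
  linarith

/-- The nodes of `γ`, together with the times at which the distance-to-measure is not small in
comparison with the length of the straight piece of `γ` containing them. -/
def mainTimes (m p : ℝ) (μ : Measure (Euc d)) (F : Set (Euc d)) (γ : ℝ → Euc d) : Set ℝ :=
  {t ∈ Icc 0 1 | t ∈ nodes F γ ∨
    m / 48 * (speedMeasure γ).real (Icc (prevNode F γ t) (nextNode F γ t)) ≤ dtm m p μ (γ t)}

lemma speedMeasure_univ_le_mainTimes [IsProbabilityMeasure μ] (hm : m ∈ Ioo (0 : ℝ) 1)
    (hp : 1 ≤ p) (hγ : LipschitzWith K γ) (hF : IsClosed F) {x y : Euc d}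
    (h : AdmissiblePath F x y γ) :
    (speedMeasure γ).real univ ≤ 2 * (speedMeasure γ).real (mainTimes m p μ F γ) := by
  have := isFiniteMeasure_speedMeasure hγ
  have hc := hγ.continuous
  set ν := speedMeasure γ with hν
  set G := mainTimes m p μ F γ with hG
  let J : ℝ → Set ℝ := fun t => Ioo (prevNode F γ t) (nextNode F γ t)
  let U : Set ℝ := Icc 0 1 \ nodes F γ
  have hcont : Continuous fun t => dtm m p μ (γ t) :=
    (lipschitzWith_dtm hm hp).continuous.comp hc
  have hJeq : ∀ t ∈ U, ∀ s ∈ J t, J s = J t := fun t ht s hs => by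
    simp only [J, prevNode_eq hF hc ht.1 hs, nextNode_eq hF hc ht.1 hs]
  have hJU : ∀ t ∈ U, J t ⊆ U := fun t ht s hs =>
    ⟨⟨(prevNode_mem hF hc ht.1).1.1.1.trans hs.1.le,
      hs.2.le.trans (nextNode_mem hF hc ht.1).1.1.2⟩, notMem_nodes_of_mem_Ioo hs⟩
  have hdisj : (J '' U).PairwiseDisjoint id := by
    rintro _ ⟨t, ht, rfl⟩ _ ⟨s, hs, rfl⟩ hne
    refine Set.disjoint_left.2 fun r hrt hrs => hne ?_
    rw [← hJeq t ht r hrt, ← hJeq s hs r hrs]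
  have hctbl : (J '' U).Countable := by
    refine hdisj.countable_of_isOpen ?_ ?_
    · rintro _ ⟨t, _, rfl⟩; exact isOpen_Ioo
    · rintro _ ⟨t, ht, rfl⟩; exact ⟨t, mem_Ioo_nodes hF hc ht.1 ht.2⟩
  have := hctbl.to_subtype
  choose! τ hτ using fun A (hA : A ∈ J '' U) => hA
  let c : Set ℝ → ℝ := fun A => m / 48 * ν.real (Icc (prevNode F γ (τ A)) (nextNode F γ (τ A)))
  have hcJ : ∀ t ∈ U, c (J t) = m / 48 * ν.real (Icc (prevNode F γ t) (nextNode F γ t)) := by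
    intro t ht
    have h1 := hτ (J t) (mem_image_of_mem J ht)
    have h2 : t ∈ J (τ (J t)) := by
      rw [h1.2]
      exact mem_Ioo_nodes hF hc ht.1 ht.2
    simp only [c, prevNode_eq hF hc h1.1.1 h2, nextNode_eq hF hc h1.1.1 h2]
  have hlow : ν (U \ G) ≤ ν G := by
    calc ν (U \ G) ≤ ν (⋃ A : J '' U, (A : Set ℝ) ∩ {t | dtm m p μ (γ t) < c A}) := by
          refine measure_mono fun t ht => mem_iUnion.2 ⟨⟨J t, mem_image_of_mem J ht.1⟩,
            mem_Ioo_nodes hF hc ht.1.1 ht.1.2, ?_⟩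
          have := fun hle => ht.2 ⟨ht.1.1, Or.inr hle⟩
          rw [mem_ofPred_eq, hcJ t ht.1]
          exact not_le.1 this
      _ ≤ ∑' A : J '' U, ν ((A : Set ℝ) ∩ {t | dtm m p μ (γ t) < c A}) := measure_iUnion_le _
      _ ≤ ∑' A : J '' U, ν ((A : Set ℝ) ∩ {t | c A ≤ dtm m p μ (γ t)}) := by
          refine ENNReal.tsum_le_tsum ?_
          rintro ⟨_, t, ht, rfl⟩
          obtain ⟨u, hu, hstr⟩ := h.straight hF hc ht.1
          rw [← ENNReal.toReal_le_toReal (measure_ne_top _ _) (measure_ne_top _ _)]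
          simp only [hcJ t ht]
          exact speedMeasure_straight_low_le hm hp hγ hu (prevNode_mem hF hc ht.1).1.1.1
            (nextNode_mem hF hc ht.1).1.1.2 hstr
      _ = ν (⋃ A : J '' U, (A : Set ℝ) ∩ {t | c A ≤ dtm m p μ (γ t)}) := by
          refine (measure_iUnion ?_ ?_).symm
          · rintro ⟨A, hA⟩ ⟨B, hB⟩ hne
            exact (hdisj hA hB fun heq => hne (Subtype.ext heq)).mono inter_subset_left
              inter_subset_left
          · rintro ⟨_, t, ht, rfl⟩
            exact measurableSet_Ioo.inter (isClosed_le continuous_const hcont).measurableSet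
      _ ≤ ν G := by
          refine measure_mono (iUnion_subset ?_)
          rintro ⟨_, t, ht, rfl⟩ s ⟨hs, hle⟩
          have hsU := hJU t ht hs
          refine ⟨hsU.1, Or.inr ?_⟩
          rw [← hcJ s hsU, hJeq t ht s hs]
          exact hle
  have hout : ν (Icc 0 1)ᶜ = 0 := by
    rw [hν, speedMeasure_apply _ measurableSet_Icc.compl]; simp
  have hall : ν univ ≤ 2 * ν G := by
    calc ν univ ≤ ν ((Icc 0 1)ᶜ ∪ (G ∪ (U \ G))) := by
          refine measure_mono fun t _ => ?_
          by_cases h1 : t ∈ Icc (0 : ℝ) 1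
          · by_cases h2 : t ∈ G
            · exact Or.inr (Or.inl h2)
            · exact Or.inr (Or.inr ⟨⟨h1, fun hn => h2 ⟨h1, Or.inl hn⟩⟩, h2⟩)
          · exact Or.inl h1
      _ ≤ ν (Icc 0 1)ᶜ + (ν G + ν (U \ G)) :=
          (measure_union_le _ _).trans (by gcongr; exact measure_union_le _ _)
      _ ≤ 0 + (ν G + ν G) := by rw [hout]; gcongr
      _ = 2 * ν G := by rw [zero_add, two_mul]
  have := ENNReal.toReal_mono (by finiteness) hall
  simpa [measureReal_def] using this

end Components

section Shortcut

variable {d : ℕ} {γ : ℝ → Euc d} {F : Set (Euc d)} {s t : ℝ}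

/-- The path obtained from `γ` by following the segment from `γ s` to `γ t` between the times
`s` and `t`. -/
def shortcut (γ : ℝ → Euc d) (s t : ℝ) (τ : ℝ) : Euc d :=
  γ (min τ s) + (γ (max τ t) - γ t) + (min (max τ s) t - s) • ((t - s)⁻¹ • (γ t - γ s))

lemma shortcut_of_le (hst : s ≤ t) {τ : ℝ} (h : τ ≤ s) : shortcut γ s t τ = γ τ := by
  simp [shortcut, min_eq_left h, max_eq_right (h.trans hst), max_eq_right h, min_eq_left hst]

lemma shortcut_of_ge (hst : s < t) {τ : ℝ} (h : t ≤ τ) : shortcut γ s t τ = γ τ := by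
  rw [shortcut, min_eq_right (hst.le.trans h), max_eq_left h, max_eq_left (hst.le.trans h),
    min_eq_right h, smul_inv_smul₀ (sub_pos.2 hst).ne']
  abel

lemma shortcut_of_mem {τ : ℝ} (h : τ ∈ Icc s t) :
    shortcut γ s t τ = γ s + (τ - s) • ((t - s)⁻¹ • (γ t - γ s)) := by
  rw [shortcut, min_eq_right h.1, max_eq_right h.2, max_eq_left h.1, min_eq_left h.2]
  simp

lemma isLipschitzPath_shortcut (hγ : IsLipschitzPath γ) (s t : ℝ) :
    IsLipschitzPath (shortcut γ s t) := by
  obtain ⟨K, hK⟩ := hγ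
  have h1 := hK.comp (LipschitzWith.id.min_const s)
  have h2 := (hK.comp (LipschitzWith.id.max_const t)).sub (LipschitzWith.const (γ t))
  have h3 := ((LipschitzWith.id.max_const s).min_const t).sub (LipschitzWith.const s)
  have h4 := (ContinuousLinearMap.toSpanSingleton ℝ
    ((t - s)⁻¹ • (γ t - γ s))).lipschitz.comp h3
  exact ⟨_, (h1.add h2).add h4⟩

lemma deriv_shortcut_of_mem {τ : ℝ} (h : τ ∈ Ioo s t) :
    deriv (shortcut γ s t) τ = (t - s)⁻¹ • (γ t - γ s) := by
  have heq : shortcut γ s t =ᶠ[nhds τ]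
      fun τ => γ s + (τ - s) • ((t - s)⁻¹ • (γ t - γ s)) := by
    filter_upwards [Icc_mem_nhds h.1 h.2] with r hr using shortcut_of_mem hr
  have h1 := (((hasDerivAt_id τ).sub_const s).smul_const
    ((t - s)⁻¹ • (γ t - γ s))).const_add (γ s)
  rw [heq.deriv_eq]
  simpa using h1.deriv

lemma shortcut_eventuallyEq (hst : s < t) {τ : ℝ} (h : τ ∉ Icc s t) :
    shortcut γ s t =ᶠ[nhds τ] γ := by
  filter_upwards [isClosed_Icc.isOpen_compl.mem_nhds h] with r hr
  rcases lt_or_ge r s with h1 | h1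
  · exact shortcut_of_le hst.le h1.le
  · exact shortcut_of_ge hst (le_of_not_ge fun h2 => hr ⟨h1, h2⟩)

lemma AdmissiblePath.shortcut {x y : Euc d} (hγ : AdmissiblePath F x y γ) (hst : s < t)
    (hs : s ∈ nodes F γ) (ht : t ∈ nodes F γ) : AdmissiblePath F x y (shortcut γ s t) := by
  refine ⟨isLipschitzPath_shortcut hγ.1 s t, ?_, ?_, fun a b ha hb hab => ?_⟩
  · rw [shortcut_of_le hst.le hs.1.1, hγ.2.1]
  · rw [shortcut_of_ge hst ht.1.2, hγ.2.2.1]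
  rcases le_or_gt b a with hba | hlt
  · rw [Ioo_eq_empty hba.not_gt]
    obtain ⟨u, hu, -⟩ := hγ.2.2.2 0 0 le_rfl zero_le_one (by simp)
    exact ⟨u, hu, by simp⟩
  have hs' : s ∉ Ioo a b := fun h => by
    have hF := hab s h
    rw [shortcut_of_le hst.le le_rfl] at hF
    rcases hs.2 with h1 | h1 | h1
    · exact hF h1
    · linarith [h.1]
    · linarith [h.2]
  have ht' : t ∉ Ioo a b := fun h => by
    have hF := hab t h
    rw [shortcut_of_ge hst le_rfl] at hF
    rcases ht.2 with h1 | h1 | h1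
    · exact hF h1
    · linarith [h.1]
    · linarith [h.2]
  have hout : (∀ τ ∈ Ioo a b, τ ∉ Icc s t) → ∃ u : Euc d, ‖u‖ = 1 ∧
      ∀ᵐ τ ∂(volume.restrict (Ioo a b)), deriv (_root_.shortcut γ s t) τ =
        ‖deriv (_root_.shortcut γ s t) τ‖ • u := fun hsub => by
    obtain ⟨u, hu, hae⟩ := hγ.2.2.2 a b ha hb fun τ hτ => by
      rw [← (shortcut_eventuallyEq (γ := γ) hst (hsub τ hτ)).self_of_nhds]
      exact hab τ hτ
    refine ⟨u, hu, ?_⟩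
    filter_upwards [hae, ae_restrict_mem measurableSet_Ioo] with τ h1 h2
    rwa [(shortcut_eventuallyEq hst (hsub τ h2)).deriv_eq]
  rcases le_or_gt b s with hbs | hsb
  · exact hout fun τ hτ h => by linarith [hτ.2, h.1]
  have has : s ≤ a := le_of_not_gt fun h => hs' ⟨h, hsb⟩
  rcases le_or_gt t a with hta | hat
  · exact hout fun τ hτ h => by linarith [hτ.1, h.2]
  have hbt : b ≤ t := le_of_not_gt fun h => ht' ⟨hat, h⟩
  have hae : ∀ᵐ τ ∂(volume.restrict (Ioo a b)),
      deriv (_root_.shortcut γ s t) τ = (t - s)⁻¹ • (γ t - γ s) := by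
    filter_upwards [ae_restrict_mem measurableSet_Ioo] with τ hτ
    exact deriv_shortcut_of_mem (Ioo_subset_Ioo has hbt hτ)
  set w := (t - s)⁻¹ • (γ t - γ s)
  rcases eq_or_ne w 0 with h0 | h0
  · obtain ⟨u, hu, -⟩ := hγ.2.2.2 0 0 le_rfl zero_le_one (by simp)
    refine ⟨u, hu, ?_⟩
    filter_upwards [hae] with τ hτ
    rw [hτ, h0]; simp
  · refine ⟨‖w‖⁻¹ • w, norm_smul_inv_norm h0, ?_⟩
    filter_upwards [hae] with τ hτ
    rw [hτ, smul_inv_smul₀ (norm_ne_zero_iff.2 h0)]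

variable {m p β : ℝ} {μ : Measure (Euc d)}

lemma integrableOn_fdtm [IsProbabilityMeasure μ] (hm : m ∈ Ioo (0 : ℝ) 1) (hp : 1 ≤ p)
    (hβ : 0 ≤ β) (hγ : IsLipschitzPath γ) :
    IntegrableOn (fun t => dtm m p μ (γ t) ^ β * ‖deriv γ t‖) (Icc 0 1) := by
  obtain ⟨K, hK⟩ := hγ
  refine IntegrableOn.continuousOn_mul (Continuous.continuousOn ?_)
    (integrable_deriv_lipschitz hK _ (by simp)).norm isCompact_Icc
  exact ((lipschitzWith_dtm hm hp).continuous.comp hK.continuous).rpow_const fun _ => Or.inr hβ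

lemma fdtm_integrand_nonneg (hm : 0 < m) (t : ℝ) :
    0 ≤ dtm m p μ (γ t) ^ β * ‖deriv γ t‖ :=
  mul_nonneg (Real.rpow_nonneg (dtm_nonneg _ hm) _) (norm_nonneg _)

lemma IsGeodesic.fdtmLength_le {x y : Euc d} {η : ℝ → Euc d} (hm : 0 < m)
    (hγ : IsGeodesic m p β μ F x y γ) (hη : AdmissiblePath F x y η) :
    fdtmLength m p β μ γ ≤ fdtmLength m p β μ η := by
  rw [hγ.2]
  refine csInf_le ⟨0, ?_⟩ ⟨η, hη, rfl⟩
  rintro _ ⟨ζ, -, rfl⟩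
  exact integral_nonneg fun t => fdtm_integrand_nonneg hm t

lemma IsGeodesic.rpow_mul_speedMeasure_le [IsProbabilityMeasure μ] (hm : m ∈ Ioo (0 : ℝ) 1)
    (hp : 1 ≤ p) (hβ : 0 ≤ β) {x y : Euc d} (hγ : IsGeodesic m p β μ F x y γ) (hst : s ≤ t)
    (hs : s ∈ nodes F γ) (ht : t ∈ nodes F γ) {S : Set ℝ} (hS : MeasurableSet S)
    (hSst : S ⊆ Icc s t) {q M : ℝ} (hq : 0 ≤ q) (hqS : ∀ τ ∈ S, q ≤ dtm m p μ (γ τ))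
    (hM : ∀ w ∈ segment ℝ (γ s) (γ t), dtm m p μ w ≤ M) :
    q ^ β * (speedMeasure γ).real S ≤ M ^ β * ‖γ t - γ s‖ := by
  rcases hst.eq_or_lt with rfl | hlt
  · have : speedMeasure γ S = 0 := measure_mono_null (by simpa using hSst) (measure_singleton s)
    simp [measureReal_def, this]
  set η := shortcut γ s t with hη
  have hη_adm : AdmissiblePath F x y η := hγ.1.shortcut hlt hs ht
  have hsub : Icc s t ⊆ Icc 0 1 := Icc_subset_Icc hs.1.1 ht.1.2
  have hiγ := integrableOn_fdtm (μ := μ) hm hp hβ hγ.1.1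
  have hiη := integrableOn_fdtm (μ := μ) hm hp hβ hη_adm.1
  have hle := hγ.fdtmLength_le hm.1 hη_adm
  rw [fdtmLength, fdtmLength, ← integral_inter_add_sdiff measurableSet_Icc hiγ (t := Icc s t),
    ← integral_inter_add_sdiff measurableSet_Icc hiη (t := Icc s t), inter_eq_right.2 hsub] at hle
  have heq : ∫ τ in Icc 0 1 \ Icc s t, dtm m p μ (γ τ) ^ β * ‖deriv γ τ‖ =
      ∫ τ in Icc 0 1 \ Icc s t, dtm m p μ (η τ) ^ β * ‖deriv η τ‖ := by
    refine setIntegral_congr_fun (measurableSet_Icc.diff measurableSet_Icc) fun τ hτ => ?_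
    have h1 := shortcut_eventuallyEq (γ := γ) hlt hτ.2
    simp only [hη, h1.deriv_eq, h1.self_of_nhds]
  have hpos : 0 < t - s := sub_pos.2 hlt
  have hup : ∫ τ in Icc s t, dtm m p μ (η τ) ^ β * ‖deriv η τ‖ ≤ M ^ β * ‖γ t - γ s‖ := by
    rw [integral_Icc_eq_integral_Ioo]
    calc ∫ τ in Ioo s t, dtm m p μ (η τ) ^ β * ‖deriv η τ‖
        ≤ ∫ _ in Ioo s t, M ^ β * ((t - s)⁻¹ * ‖γ t - γ s‖) := by
          refine setIntegral_mono_on (hiη.mono_set (Ioo_subset_Icc_self.trans hsub))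
            (integrableOn_const (by simp))
            measurableSet_Ioo fun τ hτ => ?_
          rw [hη, deriv_shortcut_of_mem hτ, norm_smul, norm_inv, Real.norm_of_nonneg hpos.le]
          refine mul_le_mul_of_nonneg_right ?_ (by positivity)
          refine Real.rpow_le_rpow (dtm_nonneg _ hm.1) (hM _ ?_) hβ
          rw [shortcut_of_mem (Ioo_subset_Icc_self hτ), segment_eq_image', smul_smul]
          refine ⟨_, ⟨mul_nonneg (by linarith [hτ.1]) (by positivity), ?_⟩, rfl⟩
          rw [← div_eq_mul_inv, div_le_one hpos]
          linarith [hτ.2]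
      _ = M ^ β * ‖γ t - γ s‖ := by
          rw [setIntegral_const, Real.volume_real_Ioo_of_le hst, smul_eq_mul]
          field_simp
  have hlow : q ^ β * (speedMeasure γ).real S ≤
      ∫ τ in Icc s t, dtm m p μ (γ τ) ^ β * ‖deriv γ τ‖ := by
    obtain ⟨K, hK⟩ := hγ.1.1
    rw [speedMeasure_real S hS, inter_eq_left.2 (hSst.trans hsub), ← integral_const_mul]
    calc ∫ τ in S, q ^ β * ‖deriv γ τ‖ ≤ ∫ τ in S, dtm m p μ (γ τ) ^ β * ‖deriv γ τ‖ := by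
          refine setIntegral_mono_on ((integrable_deriv_lipschitz hK S
            (measure_ne_top_of_subset (hSst.trans hsub) (by simp))).norm.const_mul _)
            (hiγ.mono_set (hSst.trans hsub)) hS fun τ hτ => ?_
          exact mul_le_mul_of_nonneg_right (Real.rpow_le_rpow hq (hqS τ hτ) hβ) (norm_nonneg _)
      _ ≤ _ := setIntegral_mono_set (hiγ.mono_set hsub)
          (ae_of_all _ fun τ => fdtm_integrand_nonneg hm.1 τ) hSst.eventuallyLE
  linarith

end Shortcut

section Geodesic

variable {d : ℕ} {γ : ℝ → Euc d} {F : Set (Euc d)} {m p β : ℝ} {μ : Measure (Euc d)}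

/-- The constant bounding the length of a geodesic in a dyadic layer of the distance-to-measure. -/
def layerConst (m β : ℝ) : ℝ := 4 / m * (6 + 48 / m) * (14 + 96 / m) ^ β

lemma layerConst_pos (hm : 0 < m) : 0 < layerConst m β := by
  unfold layerConst; positivity

lemma exists_nodes_of_mem_mainTimes (hF : IsClosed F) (hγ : IsLipschitzPath γ) (hm : 0 < m)
    {t r : ℝ} (ht : t ∈ mainTimes m p μ F γ) (htr : dtm m p μ (γ t) ≤ r) :
    (∃ s ∈ nodes F γ, s ≤ t ∧ dist (γ s) (γ t) ≤ 48 / m * r) ∧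
      ∃ s ∈ nodes F γ, t ≤ s ∧ dist (γ s) (γ t) ≤ 48 / m * r := by
  have hr : 0 ≤ r := (dtm_nonneg _ hm).trans htr
  rcases ht.2 with htn | hlen
  · exact ⟨⟨t, htn, le_rfl, by rw [dist_self]; positivity⟩,
      ⟨t, htn, le_rfl, by rw [dist_self]; positivity⟩⟩
  obtain ⟨K, hK⟩ := hγ
  have := isFiniteMeasure_speedMeasure hK
  obtain ⟨h1, h1'⟩ := prevNode_mem hF hK.continuous ht.1
  obtain ⟨h2, h2'⟩ := nextNode_mem hF hK.continuous ht.1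
  have hbound : (speedMeasure γ).real (Icc (prevNode F γ t) (nextNode F γ t)) ≤ 48 / m * r := by
    rw [div_mul_eq_mul_div, le_div_iff₀ hm]
    linarith
  refine ⟨⟨_, h1, h1', ?_⟩, ⟨_, h2, h2', ?_⟩⟩
  · rw [dist_comm, dist_eq_norm]
    exact (norm_sub_le_speedMeasure hK h1.1.1 h1' ht.1.2).trans
      ((measureReal_mono (Icc_subset_Icc_right h2')).trans hbound)
  · rw [dist_eq_norm]
    exact (norm_sub_le_speedMeasure hK ht.1.1 h2' h2.1.2).trans
      ((measureReal_mono (Icc_subset_Icc_left h1')).trans hbound)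

variable [IsProbabilityMeasure μ] {x y : Euc d}

lemma IsGeodesic.speedMeasure_layer_ball_le (hγ : IsGeodesic m p β μ F x y γ)
    (hm : m ∈ Ioo (0 : ℝ) 1) (hp : 1 ≤ p) (hβ : 0 ≤ β) (hF : IsClosed F) {r : ℝ} (hr : 0 < r)
    {z : Euc d} (hz : dtm m p μ z ≤ r) :
    (speedMeasure γ).real {t ∈ mainTimes m p μ F γ | dtm m p μ (γ t) ∈ Ioc (r / 2) r ∧
      γ t ∈ closedBall z (6 * r)} ≤ 2 * (6 + 48 / m) * (14 + 96 / m) ^ β * r := by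
  have hm0 := hm.1
  obtain ⟨K, hK⟩ := hγ.1.1
  have := isFiniteMeasure_speedMeasure hK
  have hcont : Continuous fun t => dtm m p μ (γ t) :=
    (lipschitzWith_dtm hm hp).continuous.comp hK.continuous
  set P := {t ∈ mainTimes m p μ F γ | dtm m p μ (γ t) ∈ Ioc (r / 2) r ∧
      γ t ∈ closedBall z (6 * r)} with hP
  set R := (6 + 48 / m) * r with hR
  have hR0 : 0 ≤ R := by positivity
  set A := nodes F γ ∩ γ ⁻¹' closedBall z R with hA
  have hAc : IsCompact A :=
    (isCompact_nodes hF hK.continuous).inter_right (isClosed_closedBall.preimage hK.continuous)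
  have hnear : ∀ t ∈ P, (∃ s ∈ A, s ≤ t) ∧ ∃ s ∈ A, t ≤ s := by
    rintro t ⟨ht, htr, htz⟩
    obtain ⟨⟨s, hs, hst, hd⟩, ⟨s', hs', hst', hd'⟩⟩ :=
      exists_nodes_of_mem_mainTimes hF ⟨K, hK⟩ hm.1 ht htr.2
    rw [mem_closedBall] at htz
    refine ⟨⟨s, ⟨hs, ?_⟩, hst⟩, ⟨s', ⟨hs', ?_⟩, hst'⟩⟩
    · rw [mem_preimage, mem_closedBall, hR]
      linarith [dist_triangle (γ s) (γ t) z]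
    · rw [mem_preimage, mem_closedBall, hR]
      linarith [dist_triangle (γ s') (γ t) z]
  rcases P.eq_empty_or_nonempty with h0 | ⟨t₀, ht₀⟩
  · rw [h0, measureReal_empty]; positivity
  have hAne : A.Nonempty := let ⟨s, hs, _⟩ := (hnear t₀ ht₀).1; ⟨s, hs⟩
  have hs := hAc.sInf_mem hAne
  have ht := hAc.sSup_mem hAne
  set s := sInf A
  set t := sSup A
  set S := Icc s t ∩ {τ | r / 2 ≤ dtm m p μ (γ τ)} with hS
  have hPS : P ⊆ S := by
    intro τ hτ
    obtain ⟨⟨a, ha, haτ⟩, ⟨b, hb, hτb⟩⟩ := hnear τ hτ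
    exact ⟨⟨(csInf_le hAc.bddBelow ha).trans haτ, hτb.trans (le_csSup hAc.bddAbove hb)⟩,
      hτ.2.1.1.le⟩
  have key := hγ.rpow_mul_speedMeasure_le hm hp hβ (csInf_le hAc.bddBelow ht) hs.1 ht.1
    (measurableSet_Icc.inter (isClosed_le continuous_const hcont).measurableSet)
    (inter_subset_left : S ⊆ Icc s t) (q := r / 2) (M := r + R) (by positivity)
    (fun τ hτ => hτ.2) (fun w hw => by
      have h1 := (convex_closedBall z R).segment_subset hs.2 ht.2 hw
      linarith [dtm_le_add_dist (μ := μ) hm hp w z, mem_closedBall.1 h1])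
  have hdist : ‖γ t - γ s‖ ≤ 2 * R := by
    rw [← dist_eq_norm]
    linarith [dist_triangle_right (γ t) (γ s) z, mem_closedBall.1 hs.2, mem_closedBall.1 ht.2]
  have hpow : (r + R) ^ β = (14 + 96 / m) ^ β * (r / 2) ^ β := by
    rw [← Real.mul_rpow (by positivity) (by positivity), hR]
    congr 1; ring
  have hrβ : 0 < (r / 2) ^ β := Real.rpow_pos_of_pos (by positivity) β
  refine (measureReal_mono hPS).trans (le_of_mul_le_mul_left ?_ hrβ)
  calc (r / 2) ^ β * (speedMeasure γ).real S ≤ (r + R) ^ β * ‖γ t - γ s‖ := key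
    _ ≤ (r + R) ^ β * (2 * R) := by gcongr
    _ = _ := by rw [hpow, hR]; ring

lemma IsGeodesic.speedMeasure_layer_le (hγ : IsGeodesic m p β μ F x y γ)
    (hm : m ∈ Ioo (0 : ℝ) 1) (hp : 1 ≤ p) (hβ : 0 ≤ β) (hF : IsClosed F) {r : ℝ} (hr : 0 < r) :
    (speedMeasure γ).real {t ∈ mainTimes m p μ F γ | dtm m p μ (γ t) ∈ Ioc (r / 2) r} ≤
      layerConst m β * r := by
  have hm0 := hm.1
  obtain ⟨K, hK⟩ := hγ.1.1
  have := isFiniteMeasure_speedMeasure hK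
  obtain ⟨T, hcard, hTr, hT⟩ := exists_finset_cover_dtm_le (μ := μ) hm hp hr
  calc _ ≤ (speedMeasure γ).real (⋃ z ∈ T, {t ∈ mainTimes m p μ F γ |
          dtm m p μ (γ t) ∈ Ioc (r / 2) r ∧ γ t ∈ closedBall z (6 * r)}) := by
        refine measureReal_mono (fun t ht => ?_) (measure_ne_top _ _)
        obtain ⟨z, hz, htz⟩ := hT (γ t) ht.2.2
        exact mem_biUnion hz ⟨ht.1, ht.2, htz⟩
    _ ≤ ∑ z ∈ T, (speedMeasure γ).real {t ∈ mainTimes m p μ F γ |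
          dtm m p μ (γ t) ∈ Ioc (r / 2) r ∧ γ t ∈ closedBall z (6 * r)} :=
        measureReal_biUnion_finset_le _ _
    _ ≤ T.card • (2 * (6 + 48 / m) * (14 + 96 / m) ^ β * r) :=
        Finset.sum_le_card_nsmul _ _ _ fun z hz =>
          hγ.speedMeasure_layer_ball_le hm hp hβ hF hr (hTr z hz)
    _ ≤ 2 / m * (2 * (6 + 48 / m) * (14 + 96 / m) ^ β * r) := by
        rw [nsmul_eq_mul]; gcongr
    _ = layerConst m β * r := by rw [layerConst]; ring

lemma IsGeodesic.speedMeasure_low_le (hγ : IsGeodesic m p β μ F x y γ)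
    (hm : m ∈ Ioo (0 : ℝ) 1) (hp : 1 ≤ p) (hβ : 0 ≤ β) (hF : IsClosed F) {r : ℝ} (hr : 0 < r) :
    (speedMeasure γ).real {t ∈ mainTimes m p μ F γ | dtm m p μ (γ t) ≤ r} ≤
      2 * layerConst m β * r := by
  obtain ⟨K, hK⟩ := hγ.1.1
  have := isFiniteMeasure_speedMeasure hK
  have hC := layerConst_pos (β := β) hm.1
  set ν := speedMeasure γ
  have hzero : ν (γ ⁻¹' {z | dtm m p μ z = 0}) = 0 := by
    rw [← biUnion_preimage_singleton]
    exact (measure_biUnion_null_iff (finite_dtm_eq_zero hm hp).countable).2 fun z _ =>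
      speedMeasure_preimage_singleton hK.continuous z
  let L : ℕ → Set ℝ := fun k => {t ∈ mainTimes m p μ F γ |
    dtm m p μ (γ t) ∈ Ioc (r * (1 / 2) ^ k / 2) (r * (1 / 2) ^ k)}
  have hL : ∀ k, ν (L k) ≤ ENNReal.ofReal (layerConst m β * r * (1 / 2) ^ k) := fun k => by
    rw [← ofReal_measureReal, mul_assoc]
    exact ENNReal.ofReal_le_ofReal (hγ.speedMeasure_layer_le hm hp hβ hF (by positivity))
  refine ENNReal.toReal_le_of_le_ofReal (by positivity) ?_
  calc ν {t ∈ mainTimes m p μ F γ | dtm m p μ (γ t) ≤ r}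
      ≤ ν (γ ⁻¹' {z | dtm m p μ z = 0} ∪ ⋃ k, L k) := by
        refine measure_mono fun t ht => ?_
        rcases (dtm_nonneg (p := p) (μ := μ) (γ t) hm.1).eq_or_lt with h0 | hpos
        · exact Or.inl h0.symm
        obtain ⟨k, hk1, hk2⟩ := exists_nat_pow_near_of_lt_one (x := dtm m p μ (γ t) / r)
          (y := 1 / 2) (by positivity) ((div_le_one hr).2 ht.2) (by norm_num) (by norm_num)
        rw [lt_div_iff₀ hr, pow_succ] at hk1
        rw [div_le_iff₀ hr] at hk2
        exact Or.inr (mem_iUnion.2 ⟨k, ht.1, by linarith, by linarith⟩)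
    _ ≤ 0 + ∑' k, ENNReal.ofReal (layerConst m β * r * (1 / 2) ^ k) := by
        refine (measure_union_le _ _).trans ?_
        rw [hzero]
        gcongr
        exact (measure_iUnion_le _).trans (ENNReal.tsum_le_tsum hL)
    _ = ENNReal.ofReal (2 * layerConst m β * r) := by
        rw [zero_add, ← ENNReal.ofReal_tsum_of_nonneg (fun k => by positivity)
          (summable_geometric_two.mul_left _), tsum_mul_left, tsum_geometric_two]
        congr 1; ring

lemma IsGeodesic.rpow_mul_speedMeasure_le_dist (hγ : IsGeodesic m p β μ F x y γ)
    (hm : m ∈ Ioo (0 : ℝ) 1) (hp : 1 ≤ p) (hβ : 0 ≤ β) {S : Set ℝ} (hS : MeasurableSet S)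
    (hS1 : S ⊆ Icc 0 1) {q : ℝ} (hq : 0 ≤ q) (hqS : ∀ τ ∈ S, q ≤ dtm m p μ (γ τ)) :
    q ^ β * (speedMeasure γ).real S ≤ (dtm m p μ x + ‖x - y‖) ^ β * ‖x - y‖ := by
  have := hγ.rpow_mul_speedMeasure_le (s := 0) (t := 1) (M := dtm m p μ x + ‖x - y‖) hm hp hβ
    zero_le_one ⟨by simp, by simp⟩ ⟨by simp, by simp⟩ hS hS1 hq hqS fun w hw => by
      rw [hγ.1.2.1, hγ.1.2.2.1] at hw
      have h1 : w ∈ closedBall x ‖x - y‖ := (convex_closedBall x _).segment_subset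
        (mem_closedBall_self (norm_nonneg _)) (by rw [mem_closedBall, dist_comm, dist_eq_norm]) hw
      linarith [dtm_le_add_dist (μ := μ) hm hp w x, mem_closedBall.1 h1]
  rwa [hγ.1.2.1, hγ.1.2.2.1, norm_sub_rev y x] at this

lemma IsGeodesic.eucLength_le_of_dtm_le (hγ : IsGeodesic m p β μ F x y γ)
    (hm : m ∈ Ioo (0 : ℝ) 1) (hp : 1 ≤ p) (hβ : 0 ≤ β) (hF : IsClosed F) {r : ℝ} (hr : 0 < r)
    (hx : dtm m p μ x + ‖x - y‖ ≤ r) :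
    eucLength γ ≤ 4 * layerConst m β * r + 2 * ‖x - y‖ := by
  obtain ⟨K, hK⟩ := hγ.1.1
  have := isFiniteMeasure_speedMeasure hK
  have hcont : Continuous fun t => dtm m p μ (γ t) :=
    (lipschitzWith_dtm hm hp).continuous.comp hK.continuous
  have hhigh : (speedMeasure γ).real (Icc 0 1 ∩ {t | r ≤ dtm m p μ (γ t)}) ≤ ‖x - y‖ := by
    refine le_of_mul_le_mul_left ((hγ.rpow_mul_speedMeasure_le_dist hm hp hβ
      (measurableSet_Icc.inter (isClosed_le continuous_const hcont).measurableSet)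
      inter_subset_left hr.le fun t ht => ht.2).trans ?_) (Real.rpow_pos_of_pos hr β)
    gcongr
    exact add_nonneg (dtm_nonneg _ hm.1) (norm_nonneg _)
  have hmain : (speedMeasure γ).real (mainTimes m p μ F γ) ≤
      (speedMeasure γ).real {t ∈ mainTimes m p μ F γ | dtm m p μ (γ t) ≤ r} +
        (speedMeasure γ).real (Icc 0 1 ∩ {t | r ≤ dtm m p μ (γ t)}) := by
    refine (measureReal_mono fun t ht => ?_).trans (measureReal_union_le _ _)
    exact (le_total (dtm m p μ (γ t)) r).imp (fun h => ⟨ht, h⟩) fun h => ⟨ht.1, h⟩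
  rw [eucLength_eq_speedMeasure]
  linarith [speedMeasure_univ_le_mainTimes (μ := μ) hm hp hK hF hγ.1,
    hγ.speedMeasure_low_le hm hp hβ hF hr]

lemma IsGeodesic.eucLength_le_of_lt_dtm (hγ : IsGeodesic m p β μ F x y γ)
    (hm : m ∈ Ioo (0 : ℝ) 1) (hp : 1 ≤ p) (hβ : 0 ≤ β)
    (hx : 2 * 4 ^ β * ‖x - y‖ < dtm m p μ x) : eucLength γ ≤ 4 ^ β * ‖x - y‖ := by
  obtain ⟨K, hK⟩ := hγ.1.1
  have := isFiniteMeasure_speedMeasure hK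
  have hcont : Continuous fun t => dtm m p μ (γ t) :=
    (lipschitzWith_dtm hm hp).continuous.comp hK.continuous
  set h := dtm m p μ x with hh
  have h4 : (1 : ℝ) ≤ 4 ^ β := Real.one_le_rpow (by norm_num) hβ
  have hD := norm_nonneg (x - y)
  have hpos : 0 < h := lt_of_le_of_lt (by positivity) hx
  have hDh : ‖x - y‖ ≤ h := by nlinarith
  have hbound : ∀ S, MeasurableSet S → S ⊆ Icc 0 1 → (∀ τ ∈ S, h / 2 ≤ dtm m p μ (γ τ)) →
      (speedMeasure γ).real S ≤ 4 ^ β * ‖x - y‖ := fun S hS hS1 hqS => by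
    refine le_of_mul_le_mul_left ((hγ.rpow_mul_speedMeasure_le_dist hm hp hβ hS hS1
      (by positivity) hqS).trans ?_) (Real.rpow_pos_of_pos (half_pos hpos) β)
    rw [← mul_assoc, ← Real.mul_rpow (by positivity) (by positivity)]
    gcongr
    linarith
  have hfar : ∀ t ∈ Icc (0 : ℝ) 1, h / 2 < dtm m p μ (γ t) := by
    by_contra! hex
    set A := Icc (0 : ℝ) 1 ∩ {t | dtm m p μ (γ t) ≤ h / 2} with hA
    have hAc : IsCompact A := isCompact_Icc.inter_right (isClosed_le hcont continuous_const)
    have hT := hAc.sInf_mem hex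
    set T := sInf A
    have h1 : (speedMeasure γ).real (Ico 0 T) ≤ 4 ^ β * ‖x - y‖ :=
      hbound _ measurableSet_Ico (fun t ht => ⟨ht.1, ht.2.le.trans hT.1.2⟩) fun t ht => by
        by_contra! hlt
        exact (csInf_le hAc.bddBelow ⟨⟨ht.1, ht.2.le.trans hT.1.2⟩, hlt.le⟩).not_gt ht.2
    rw [measureReal_congr Ico_ae_eq_Icc] at h1
    have h2 := norm_sub_le_speedMeasure hK le_rfl hT.1.1 hT.1.2
    have h3 := dtm_le_add_dist (μ := μ) hm hp x (γ T)
    rw [hγ.1.2.1, ← dist_eq_norm, dist_comm] at h2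
    have h5 : dtm m p μ (γ T) ≤ h / 2 := hT.2
    linarith
  rw [eucLength_eq_speedMeasure, speedMeasure_real _ MeasurableSet.univ, univ_inter,
    ← inter_self (Icc (0 : ℝ) 1), ← speedMeasure_real _ measurableSet_Icc]
  exact hbound _ measurableSet_Icc subset_rfl fun t ht => (hfar t ht).le

end Geodesic

lemma layerConst_le {m β : ℝ} (hm : m ∈ Ioo (0 : ℝ) 1) (hβ : 0 ≤ β) :
    layerConst m β ≤ 216 * 110 ^ β / m ^ (2 + β) := by
  have hm0 := hm.1
  have hinv : 1 ≤ 1 / m := (one_le_div hm0).2 hm.2.le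
  have h1 : (14 + 96 / m) ^ β ≤ 110 ^ β / m ^ β := by
    rw [← Real.div_rpow (by norm_num) hm0.le]
    refine Real.rpow_le_rpow (by positivity) ?_ hβ
    calc 14 + 96 / m = 14 + 96 * (1 / m) := by ring
      _ ≤ 110 * (1 / m) := by linarith
      _ = 110 / m := by ring
  have h2 : 6 + 48 / m ≤ 54 / m := by
    calc 6 + 48 / m = 6 + 48 * (1 / m) := by ring
      _ ≤ 54 * (1 / m) := by linarith
      _ = 54 / m := by ring
  calc layerConst m β ≤ 4 / m * (54 / m) * (110 ^ β / m ^ β) := by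
        unfold layerConst; gcongr
    _ = 216 * 110 ^ β / m ^ (2 + β) := by
        rw [Real.rpow_add hm0, Real.rpow_two]
        field_simp; ring

lemma le_fdtmConst {m β : ℝ} (hm : m ∈ Ioo (0 : ℝ) 1) (hβ : 0 ≤ β) :
    2304 * 5280 ^ β / m ^ (2 + β) ≤ fdtmConst m β := by
  have hm0 := hm.1
  have hinv : 1 ≤ 1 / m := (one_le_div hm0).2 hm.2.le
  have hρ : 32 ≤ 1 + 32 / m := by
    have : 32 / m = 32 * (1 / m) := by ring
    linarith
  have hpow : 32 ^ β * (32 / m) ≤ (1 + 32 / m) ^ (β + 1) := by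
    rw [Real.rpow_add (by positivity), Real.rpow_one]
    gcongr
    linarith
  calc 2304 * 5280 ^ β / m ^ (2 + β)
      = 2 * ((0 + 1152 * (165 : ℝ) ^ β) / m ^ (2 + β)) * (32 ^ β * (32 / m)) / (32 / m) := by
        rw [show (5280 : ℝ) = 165 * 32 by norm_num, Real.mul_rpow (by norm_num) (by norm_num)]
        field_simp
        ring
    _ ≤ fdtmConst m β := by
        unfold fdtmConst
        rw [add_sub_cancel_left]
        gcongr
        positivity

theorem eucLength_geodesic_le_dist {d : ℕ} (m p β : ℝ) (hm : m ∈ Set.Ioo (0 : ℝ) 1) (hp : 1 ≤ p)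
    (hβ : 1 ≤ β) (μ : Measure (Euc d)) [IsProbabilityMeasure μ]
    (F : Set (Euc d)) (hF : IsClosed F) (hFne : F.Nonempty) (x y : Euc d)
    (γ : ℝ → Euc d) (hγ : IsGeodesic m p β μ F x y γ) :
    eucLength γ ≤ ((2 : ℝ) ^ (β + 2) + 1) * fdtmConst m β * ‖x - y‖ := by
  have hm0 := hm.1
  have hβ0 : 0 ≤ β := zero_le_one.trans hβ
  have hD := norm_nonneg (x - y)
  have hC := layerConst_pos (β := β) hm0
  have h4 : (1 : ℝ) ≤ 4 ^ β := Real.one_le_rpow (by norm_num) hβ0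
  have hmpos : 0 < m ^ (2 + β) := Real.rpow_pos_of_pos hm0 _
  have hm1 : m ^ (2 + β) ≤ 1 := Real.rpow_le_one hm0.le hm.2.le (by linarith)
  have h440 : (440 : ℝ) ^ β = 110 ^ β * 4 ^ β := by
    rw [← Real.mul_rpow (by norm_num) (by norm_num)]; norm_num
  have h5280 : (440 : ℝ) ^ β ≤ 5280 ^ β := Real.rpow_le_rpow (by norm_num) (by norm_num) hβ0
  have h110 : (1 : ℝ) ≤ 110 ^ β := Real.one_le_rpow (by norm_num) hβ0
  have hconst : 2594 * 440 ^ β / m ^ (2 + β) ≤ ((2 : ℝ) ^ (β + 2) + 1) * fdtmConst m β := by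
    have h2 : (1 : ℝ) ≤ 2 ^ (β + 2) := Real.one_le_rpow (by norm_num) (by linarith)
    calc 2594 * 440 ^ β / m ^ (2 + β) ≤ 2 * (2304 * 5280 ^ β / m ^ (2 + β)) := by
          rw [← mul_div_assoc]
          refine div_le_div_of_nonneg_right ?_ hmpos.le
          linarith [Real.rpow_nonneg (show (0 : ℝ) ≤ 440 by norm_num) β]
      _ ≤ _ := mul_le_mul (by linarith) (le_fdtmConst hm hβ0) (by positivity) (by positivity)
  refine le_trans ?_ (mul_le_mul_of_nonneg_right hconst hD)
  obtain hx | hx := lt_or_ge (2 * 4 ^ β * ‖x - y‖) (dtm m p μ x)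
  · refine (hγ.eucLength_le_of_lt_dtm hm hp hβ0 hx).trans (mul_le_mul_of_nonneg_right ?_ hD)
    rw [le_div_iff₀ hmpos, h440]
    nlinarith
  have hlim : (eucLength γ - 2 * ‖x - y‖) / (4 * layerConst m β) ≤
      (2 * 4 ^ β + 1) * ‖x - y‖ := by
    refine le_of_forall_gt_imp_ge_of_dense fun r hr => ?_
    have hr0 : 0 < r := lt_of_le_of_lt (by positivity) hr
    rw [div_le_iff₀ (by positivity)]
    linarith [hγ.eucLength_le_of_dtm_le hm hp hβ0 hF hr0 (by linarith)]
  rw [div_le_iff₀ (by positivity)] at hlim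
  calc eucLength γ
      ≤ (4 * (3 * 4 ^ β) * layerConst m β + 2) * ‖x - y‖ := by
        have : 4 * layerConst m β * ‖x - y‖ * 1 ≤ 4 * layerConst m β * ‖x - y‖ * 4 ^ β := by
          gcongr
        linarith
    _ ≤ (4 * (3 * 4 ^ β) * (216 * 110 ^ β / m ^ (2 + β)) + 2 * 440 ^ β / m ^ (2 + β)) *
        ‖x - y‖ := by
        gcongr
        · exact layerConst_le hm hβ0
        · rw [le_div_iff₀ hmpos, h440]
          nlinarith
    _ = 2594 * 440 ^ β / m ^ (2 + β) * ‖x - y‖ := by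
        rw [h440]; ring

end
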